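/- Let B be a transition-based generalized Büchi automaton and B̄ its augmented automaton (as defined via memory vectors visitf, Max, reset). Then every infinite word accepted by B̄ is accepted by B. In particular, L(B) = L(B̄). -/

import Mathlib

-- Reset function on memory vectors (subsets of `Fin n`): maps the all-ones
-- vector (`Set.univ`) to the all-zeros vector (`∅`), identity otherwise.
open Classical in
noncomputable def reset {n : ℕ} (v : Set (Fin n)) : Set (Fin n) :=
  if v = Set.univ then ∅ else v

/-- A transition-based generalized Büchi automaton with `n` accepting sets. -/
structure TGBA (X A : Type) (n : ℕ) where
  init : X
  trans : Set (X × A × X)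
  acc : Fin n → Set (X × A × X)

/-- `visitf e` is the memory vector whose `j`-th entry is 1 iff `e ∈ F j`. -/
def visitf {X A : Type} {n : ℕ} (B : TGBA X A n) (e : X × A × X) : Set (Fin n) :=
  {j | e ∈ B.acc j}

/-- The augmented automaton of a tGBA: states are pairs of a state and a
memory vector, the memory is updated by `reset (Max (v, visitf e))`, and
the `j`-th accepting set consists of the augmented transitions whose
underlying transition is in `F j` and whose memory has `j`-th entry 0. -/
noncomputable def TGBA.aug {X A : Type} {n : ℕ} (B : TGBA X A n) :
    TGBA (X × Set (Fin n)) A n where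
  init := (B.init, ∅)
  trans := {t | (t.1.1, t.2.1, t.2.2.1) ∈ B.trans ∧
    t.2.2.2 = reset (t.1.2 ∪ visitf B (t.1.1, t.2.1, t.2.2.1))}
  acc := fun j => {t | ((t.1.1, t.2.1, t.2.2.1) ∈ B.trans ∧
    t.2.2.2 = reset (t.1.2 ∪ visitf B (t.1.1, t.2.1, t.2.2.1))) ∧
    (t.1.1, t.2.1, t.2.2.1) ∈ B.acc j ∧ j ∉ t.1.2}

/-- Acceptance of an infinite word: some infinite run from the initial state
takes, for each `j`, transitions in the `j`-th accepting set infinitely often. -/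
def TGBA.Accepts {X A : Type} {n : ℕ} (B : TGBA X A n) (w : ℕ → A) : Prop :=
  ∃ r : ℕ → X, r 0 = B.init ∧ (∀ k, (r k, w k, r (k + 1)) ∈ B.trans) ∧
    ∀ j : Fin n, ∀ N : ℕ, ∃ k ≥ N, (r k, w k, r (k + 1)) ∈ B.acc j

theorem reset_subset' {n : ℕ} (v : Set (Fin n)) : reset v ⊆ v := by
  unfold reset
  split_ifs
  · exact Set.empty_subset _
  · exact subset_rfl

/-- If every index is visited infinitely often, then the memory is reset infinitely often. -/
theorem exists_full {n : ℕ} (u v : ℕ → Set (Fin n))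
    (hv : ∀ k, v (k + 1) = reset (v k ∪ u k))
    (hu : ∀ j : Fin n, ∀ N : ℕ, ∃ k ≥ N, j ∈ u k) (N : ℕ) :
    ∃ k ≥ N, v k ∪ u k = Set.univ := by
  by_contra! hne
  have hstep : ∀ k ≥ N, v (k + 1) = v k ∪ u k := by
    intro k hk
    rw [hv k, reset, if_neg (hne k hk)]
  have hmono : ∀ a ≥ N, ∀ b ≥ a, v a ⊆ v b := by
    intro a ha b hb
    induction b, hb using Nat.le_induction with
    | base => exact subset_rfl
    | succ m hm ih =>
      rw [hstep m (le_trans ha hm)]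
      exact ih.trans Set.subset_union_left
  choose f hf hfu using fun j => hu j N
  let M := N + ∑ j, (f j + 1)
  apply hne M (Nat.le_add_right _ _)
  apply Set.eq_univ_of_forall
  intro j
  left
  have h1 : f j + 1 ≤ ∑ j, (f j + 1) :=
    Finset.single_le_sum (f := fun j => f j + 1) (fun _ _ => Nat.zero_le _) (Finset.mem_univ j)
  have hfj := hf j
  apply hmono (f j + 1) (by omega) M (by omega)
  rw [hstep _ (hf j)]
  exact Or.inr (hfu j)

theorem exists_fresh {n : ℕ} (u v : ℕ → Set (Fin n))
    (hv : ∀ k, v (k + 1) = reset (v k ∪ u k))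
    (hu : ∀ j : Fin n, ∀ N : ℕ, ∃ k ≥ N, j ∈ u k) (j : Fin n) (N : ℕ) :
    ∃ k ≥ N, j ∈ u k ∧ j ∉ v k := by
  by_contra! hne
  obtain ⟨k, hk, hfull⟩ := exists_full u v hv hu N
  have hout : ∀ m ≥ k + 1, j ∉ v m := by
    intro m hm
    induction m, hm using Nat.le_induction with
    | base => rw [hv k, reset, if_pos hfull]; exact Set.notMem_empty j
    | succ m hm ih =>
      rw [hv m]
      intro h
      rcases reset_subset' _ h with h | h
      · exact ih h
      · exact ih (hne m (by omega) h)
  obtain ⟨m, hm, hjm⟩ := hu j (k + 1)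
  exact hout m hm (hne m (by omega) hjm)

/-- every infinite word accepted by the augmented automaton `B.aug`
is accepted by the original tGBA `B`; in particular `L(B) = L(B.aug)`. -/
theorem accepted_of_accepted_by_aug {X A : Type} {n : ℕ} (B : TGBA X A n) :
    (∀ w : ℕ → A, B.aug.Accepts w → B.Accepts w) ∧
    (∀ w : ℕ → A, B.Accepts w ↔ B.aug.Accepts w) := by
  have h1 : ∀ w : ℕ → A, B.aug.Accepts w → B.Accepts w := by
    rintro w ⟨r, h0, ht, ha⟩
    refine ⟨fun k => (r k).1, by beta_reduce; rw [h0]; rfl, fun k => (ht k).1, fun j N => ?_⟩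
    obtain ⟨k, hk, h⟩ := ha j N
    exact ⟨k, hk, h.2.1⟩
  refine ⟨h1, fun w => ⟨?_, h1 w⟩⟩
  rintro ⟨r, h0, ht, ha⟩
  let u : ℕ → Set (Fin n) := fun k => visitf B (r k, w k, r (k + 1))
  let v : ℕ → Set (Fin n) := fun k => Nat.rec ∅ (fun m s => reset (s ∪ u m)) k
  have hv : ∀ k, v (k + 1) = reset (v k ∪ u k) := fun _ => rfl
  refine ⟨fun k => (r k, v k), by beta_reduce; rw [h0]; rfl, fun k => ⟨ht k, hv k⟩, fun j N => ?_⟩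
  obtain ⟨k, hk, h, h'⟩ := exists_fresh u v hv ha j N
  exact ⟨k, hk, ⟨ht k, hv k⟩, h, h'⟩
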